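/- arXiv:2108.09844 — 4 statements merged into one kernel-verified Lean document; each statement's English description precedes it below -/
import Mathlib

section
/- Define k(s,ε) = (s − ε)/h_μ(s) for s > 0, ε > 0. Then k is real-analytic on (0,∞) × (0,∞); for every fixed ε > 0 the map s ↦ k(s,ε) is a strictly increasing bijection from (ε,∞) onto (0,∞); and the map s ↦ k(s,0) = s/h_μ(s) is a strictly increasing bijection from (0,∞) onto (λ₁(μ)², ∞). -/
open MeasureTheory

open Filter Topology

theorem aux_pos (μ : Measure ℝ) [IsProbabilityMeasure μ] (f : ℝ → ℝ) (hf : Integrable f μ)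
    (hp : ∀ u, 0 < f u) : 0 < ∫ u, f u ∂μ := by
  rw [integral_pos_iff_support_of_nonneg (fun u => (hp u).le) hf]
  have : Function.support f = Set.univ := by
    ext u; simp [(hp u).ne']
  simp [this]

theorem aux_int (μ : Measure ℝ) [IsProbabilityMeasure μ] {s : ℝ} (hs : 0 < s) :
    Integrable (fun u : ℝ => 1 / (s ^ 2 + u ^ 2)) μ := by
  refine Integrable.of_bound (C := 1 / s ^ 2) ?_ ?_
  · exact Measurable.aestronglyMeasurable (by fun_prop)
  · refine Eventually.of_forall fun u => ?_
    rw [Real.norm_of_nonneg (by positivity)]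
    exact one_div_le_one_div_of_le (by positivity) (by nlinarith [sq_nonneg u])

theorem aux_ne {z : ℂ} (hz : 0 < z.re) (u : ℝ) : z + u * Complex.I ≠ 0 := by
  intro h
  have := congrArg Complex.re h
  simp at this
  linarith

theorem aux_norm {z : ℂ} {r : ℝ} (hr : 0 < r) (hz : r ≤ z.re) (u : ℝ) :
    ‖(z + u * Complex.I)⁻¹‖ ≤ r⁻¹ := by
  rw [norm_inv]
  apply inv_anti₀ hr
  refine le_trans ?_ (Complex.re_le_norm _)
  simpa using hz

theorem aux_meas (z : ℂ) : Measurable (fun u : ℝ => (z + u * Complex.I)⁻¹) := by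
  fun_prop

theorem aux_cint (μ : Measure ℝ) [IsProbabilityMeasure μ] {z : ℂ} (hz : 0 < z.re) :
    Integrable (fun u : ℝ => (z + u * Complex.I)⁻¹) μ :=
  Integrable.of_bound (C := (z.re)⁻¹) (aux_meas z).aestronglyMeasurable
    (Eventually.of_forall fun u => aux_norm hz le_rfl u)

theorem aux_diff (μ : Measure ℝ) [IsProbabilityMeasure μ] {z : ℂ} (hz : 0 < z.re) :
    DifferentiableAt ℂ (fun z : ℂ => ∫ u : ℝ, (z + u * Complex.I)⁻¹ ∂μ) z := by
  have hopen : IsOpen {w : ℂ | z.re / 2 < w.re} := isOpen_lt continuous_const Complex.continuous_re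
  have hmem : {w : ℂ | z.re / 2 < w.re} ∈ 𝓝 z := hopen.mem_nhds (by simp; linarith)
  refine (hasDerivAt_integral_of_dominated_loc_of_deriv_le
    (F := fun (z : ℂ) (u : ℝ) => (z + u * Complex.I)⁻¹)
    (F' := fun (z : ℂ) (u : ℝ) => -1 / (z + u * Complex.I) ^ 2)
    (bound := fun _ => ((z.re / 2)⁻¹) ^ 2) hmem
    (Eventually.of_forall fun w => (aux_meas w).aestronglyMeasurable)
    (aux_cint μ hz) ?_ ?_ ?_ ?_).2.differentiableAt
  · exact Measurable.aestronglyMeasurable (by fun_prop)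
  · refine Eventually.of_forall fun u w hw => ?_
    have := aux_norm (r := z.re / 2) (by positivity) (le_of_lt hw) u
    rw [neg_div, norm_neg, one_div, ← inv_pow, norm_pow]
    gcongr
  · exact integrable_const _
  · refine Eventually.of_forall fun u w hw => ?_
    have hw' : 0 < w.re := lt_trans (by positivity) hw
    exact ((hasDerivAt_id w).add_const _).inv (aux_ne hw' u)

theorem aux_analytic (μ : Measure ℝ) [IsProbabilityMeasure μ] {s : ℝ} (hs : 0 < s) :
    AnalyticAt ℝ (fun s : ℝ => ∫ u, s / (s ^ 2 + u ^ 2) ∂μ) s := by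
  have hopen : IsOpen {w : ℂ | 0 < w.re} := isOpen_lt continuous_const Complex.continuous_re
  have hd : DifferentiableOn ℂ (fun z : ℂ => ∫ u : ℝ, (z + u * Complex.I)⁻¹ ∂μ)
      {w : ℂ | 0 < w.re} := fun w hw => (aux_diff μ hw).differentiableWithinAt
  have ha := (hd.analyticAt (hopen.mem_nhds (show (s : ℂ) ∈ {w : ℂ | 0 < w.re} by simpa using hs)))
  have h1 : AnalyticAt ℝ (fun x : ℝ => (∫ u : ℝ, ((x : ℂ) + u * Complex.I)⁻¹ ∂μ)) s :=
    (ha.restrictScalars (𝕜 := ℝ)).comp (Complex.ofRealCLM.analyticAt s)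
  have h2 : AnalyticAt ℝ (fun x : ℝ => Complex.reCLM (∫ u : ℝ, ((x : ℂ) + u * Complex.I)⁻¹ ∂μ)) s :=
    (Complex.reCLM.analyticAt _).comp h1
  refine h2.congr ?_
  filter_upwards [lt_mem_nhds hs] with x hx
  rw [← ContinuousLinearMap.integral_comp_comm _ (aux_cint μ (by simpa using hx))]
  congr 1
  ext u
  simp [Complex.inv_re, Complex.normSq_apply]
  ring

theorem aux_lam (μ : Measure ℝ) [IsProbabilityMeasure μ] (y : ℝ) (hy : 0 < y)
    (H : ∀ s : ℝ, 0 < s → ∫ u, 1 / (s ^ 2 + u ^ 2) ∂μ ≤ 1 / y) :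
    y ≤ ((∫⁻ u, (ENNReal.ofReal (u ^ 2))⁻¹ ∂μ)⁻¹).toReal := by
  have key : ∫⁻ u, (ENNReal.ofReal (u ^ 2))⁻¹ ∂μ ≤ ENNReal.ofReal (1 / y) := by
    have hlim : Tendsto (fun n : ℕ => ∫⁻ u, (ENNReal.ofReal ((1 / ((n : ℝ) + 1)) ^ 2 + u ^ 2))⁻¹ ∂μ)
        atTop (𝓝 (∫⁻ u, (ENNReal.ofReal (u ^ 2))⁻¹ ∂μ)) := by
      refine lintegral_tendsto_of_tendsto_of_monotone ?_ ?_ ?_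
      · intro n
        exact Measurable.aemeasurable (by fun_prop)
      · refine Eventually.of_forall fun u n m hnm => ?_
        dsimp only
        gcongr
      · refine Eventually.of_forall fun u => ?_
        have h0 : Tendsto (fun n : ℕ => (1 / ((n : ℝ) + 1)) ^ 2 + u ^ 2) atTop (𝓝 (u ^ 2)) := by
          simpa using ((tendsto_one_div_add_atTop_nhds_zero_nat (𝕜 := ℝ)).pow 2).add_const (u ^ 2)
        exact (ENNReal.tendsto_ofReal h0).inv
    refine le_of_tendsto' hlim fun n => ?_
    have hn : (0 : ℝ) < 1 / ((n : ℝ) + 1) := by positivity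
    refine le_trans (le_of_eq ?_) (ENNReal.ofReal_le_ofReal (H _ hn))
    rw [ofReal_integral_eq_lintegral_ofReal (aux_int μ hn)
      (Eventually.of_forall fun u => by positivity)]
    congr 1
    ext u
    rw [one_div (_ ^ 2 + u ^ 2), ENNReal.ofReal_inv_of_pos (by positivity)]
  have hpos : ∫⁻ u, (ENNReal.ofReal (u ^ 2))⁻¹ ∂μ ≠ 0 := by
    intro h0
    rw [lintegral_eq_zero_iff (by fun_prop)] at h0
    obtain ⟨u, hu⟩ := h0.exists
    simp at hu
  have h2 := ENNReal.inv_le_inv.2 key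
  have h3 := ENNReal.toReal_mono (ENNReal.inv_ne_top.2 hpos) h2
  rw [← ENNReal.ofReal_inv_of_pos (by positivity), ENNReal.toReal_ofReal (by positivity)] at h3
  simpa using h3

theorem aux_lam2 (μ : Measure ℝ) [IsProbabilityMeasure μ] (s : ℝ) (hs : 0 < s) :
    ((∫⁻ u, (ENNReal.ofReal (u ^ 2))⁻¹ ∂μ)⁻¹).toReal ≤ (∫ u, 1 / (s ^ 2 + u ^ 2) ∂μ)⁻¹ := by
  have hg : 0 < ∫ u, 1 / (s ^ 2 + u ^ 2) ∂μ :=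
    aux_pos μ _ (aux_int μ hs) fun u => by positivity
  have key : ENNReal.ofReal (∫ u, 1 / (s ^ 2 + u ^ 2) ∂μ) ≤
      ∫⁻ u, (ENNReal.ofReal (u ^ 2))⁻¹ ∂μ := by
    rw [ofReal_integral_eq_lintegral_ofReal (aux_int μ hs)
      (Eventually.of_forall fun u => by positivity)]
    refine lintegral_mono fun u => ?_
    dsimp only
    rw [one_div (_ + _), ENNReal.ofReal_inv_of_pos (by positivity)]
    gcongr
    nlinarith
  have h2 := ENNReal.inv_le_inv.2 key
  rw [← ENNReal.ofReal_inv_of_pos hg] at h2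
  have h3 := ENNReal.toReal_mono ENNReal.ofReal_ne_top h2
  rwa [ENNReal.toReal_ofReal (by positivity)] at h3

/-- Let `μ` be a Borel probability measure on `[0,∞)`, let
`h_μ(s) = ∫ s/(s²+u²) dμ(u)` and `λ₁(μ)² = (∫ 1/u² dμ(u))⁻¹` (extended sense).
Define `k(s,ε) = (s−ε)/h_μ(s)`. Then `k` is real-analytic on `(0,∞)×(0,∞)`;
for each `ε > 0` the map `s ↦ k(s,ε)` is a strictly increasing bijection from
`(ε,∞)` onto `(0,∞)`; and `s ↦ k(s,0) = s/h_μ(s)` is a strictly increasing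
bijection from `(0,∞)` onto `(λ₁(μ)², ∞)`. -/
theorem stmt_2 (μ : Measure ℝ) [IsProbabilityMeasure μ] (hsupp : μ (Set.Iio 0) = 0)
    (h : ℝ → ℝ) (hh : ∀ s : ℝ, h s = ∫ u, s / (s ^ 2 + u ^ 2) ∂μ)
    (lamSq : ℝ)
    (hlam : lamSq = ((∫⁻ u, (ENNReal.ofReal (u ^ 2))⁻¹ ∂μ)⁻¹).toReal)
    (k : ℝ → ℝ → ℝ) (hk : ∀ s ε : ℝ, k s ε = (s - ε) / h s) :
    AnalyticOnNhd ℝ (fun p : ℝ × ℝ => k p.1 p.2)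
      (Set.Ioi (0 : ℝ) ×ˢ Set.Ioi (0 : ℝ)) ∧
    (∀ ε : ℝ, 0 < ε → StrictMonoOn (fun s => k s ε) (Set.Ioi ε) ∧
      Set.BijOn (fun s => k s ε) (Set.Ioi ε) (Set.Ioi (0 : ℝ))) ∧
    (StrictMonoOn (fun s => k s 0) (Set.Ioi (0 : ℝ)) ∧
      Set.BijOn (fun s => k s 0) (Set.Ioi (0 : ℝ)) (Set.Ioi lamSq)) := by
  obtain ⟨g, hg⟩ : ∃ g : ℝ → ℝ, ∀ s, g s = ∫ u, 1 / (s ^ 2 + u ^ 2) ∂μ := ⟨_, fun _ => rfl⟩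
  have hhg : ∀ s, h s = s * g s := by
    intro s
    rw [hh, hg, ← integral_const_mul]
    simp only [mul_one_div]
  have gpos : ∀ s, 0 < s → 0 < g s := fun s hs => by
    rw [hg]
    exact aux_pos μ _ (aux_int μ hs) fun u => by positivity
  have hpos : ∀ s, 0 < s → 0 < h s := fun s hs => by
    rw [hhg]
    exact mul_pos hs (gpos s hs)
  have ganti : ∀ s t, 0 < s → s < t → g t < g s := fun s t hs hst => by
    have ht := hs.trans hst
    rw [← sub_pos, hg, hg, ← integral_sub (aux_int μ hs) (aux_int μ ht)]
    refine aux_pos μ _ ((aux_int μ hs).sub (aux_int μ ht)) fun u => ?_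
    rw [sub_pos]
    refine one_div_lt_one_div_of_lt (by positivity) ?_
    gcongr
  have gle : ∀ s, 0 < s → g s ≤ 1 / s ^ 2 := fun s hs => by
    have := integral_mono (aux_int μ hs) (integrable_const (1 / s ^ 2)) (fun u =>
      one_div_le_one_div_of_le (by positivity) (by nlinarith [sq_nonneg u]))
    rw [hg]
    simpa using this
  have hle : ∀ s, 0 < s → s * h s ≤ 1 := fun s hs => by
    have := gle s hs
    rw [le_div_iff₀ (by positivity)] at this
    rw [hhg]
    linarith
  have han : ∀ s, 0 < s → AnalyticAt ℝ h s := fun s hs => by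
    have := aux_analytic μ hs
    rwa [← funext hh] at this
  have k0 : ∀ s, 0 < s → k s 0 = (g s)⁻¹ := fun s hs => by
    rw [hk, hhg]
    have := (gpos s hs).ne'
    field_simp
    simp
  have kε : ∀ s ε, 0 < s → k s ε = (1 - ε / s) * (g s)⁻¹ := fun s ε hs => by
    rw [hk, hhg]
    have := (gpos s hs).ne'
    field_simp
  have kcont : ∀ ε s, 0 < s → ContinuousAt (fun s => k s ε) s := fun ε s hs => by
    simp only [hk]
    exact (continuousAt_id.sub continuousAt_const).div (han s hs).continuousAt (hpos s hs).ne'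
  have ginv : ∀ s t, 0 < s → s < t → (g s)⁻¹ < (g t)⁻¹ := fun s t hs hst =>
    inv_strictAnti₀ (gpos t (hs.trans hst)) (ganti s t hs hst)
  have klarge : ∀ ε y : ℝ, 0 ≤ ε → 0 ≤ y → ∃ s, ε < s ∧ 0 < s ∧ y ≤ k s ε := fun ε y hε hy => by
    refine ⟨ε + 1 + y, by linarith, by linarith, ?_⟩
    have hs : 0 < ε + 1 + y := by linarith
    rw [hk, le_div_iff₀ (hpos _ hs)]
    have h1 := hle _ hs
    have h2 := hpos _ hs
    have h3 : h (ε + 1 + y) ≤ 1 := by nlinarith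
    nlinarith
  have mono0 : StrictMonoOn (fun s => k s 0) (Set.Ioi (0 : ℝ)) := by
    intro s hs t ht hst
    simp only [Set.mem_Ioi] at hs ht
    simp only [k0 s hs, k0 t ht]
    exact ginv s t hs hst
  have lamnn : 0 ≤ lamSq := by rw [hlam]; exact ENNReal.toReal_nonneg
  refine ⟨?_, ?_, mono0, ?_, mono0.injOn, ?_⟩
  · rintro ⟨s, ε⟩ ⟨hs, -⟩
    simp only [hk]
    exact (analyticAt_fst.sub analyticAt_snd).div
      ((han s hs).comp (f := fun p : ℝ × ℝ => p.1) (x := (s, ε)) analyticAt_fst) (hpos s hs).ne'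
  · intro ε hε
    have mono : StrictMonoOn (fun s => k s ε) (Set.Ioi ε) := by
      intro s hs t ht hst
      simp only [Set.mem_Ioi] at hs ht
      have hs0 := hε.trans hs
      have ht0 := hε.trans ht
      simp only [kε s ε hs0, kε t ε ht0]
      have h1 : ε / t < ε / s := div_lt_div_of_pos_left hε hs0 hst
      have h2 : ε / s < 1 := (div_lt_one hs0).2 hs
      exact mul_lt_mul'' (by linarith) (ginv s t hs0 hst) (by linarith)
        (inv_pos.2 (gpos s hs0)).le
    refine ⟨mono, ?_, mono.injOn, ?_⟩
    · intro s hs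
      simp only [Set.mem_Ioi] at hs ⊢
      rw [hk]
      exact div_pos (by linarith) (hpos s (hε.trans hs))
    · intro y hy
      simp only [Set.mem_Ioi] at hy
      obtain ⟨b, hb, -, hyb⟩ := klarge ε y hε.le hy.le
      have hev : ∀ᶠ s in 𝓝[>] ε, k s ε < y := by
        have : Tendsto (fun s => k s ε) (𝓝[>] ε) (𝓝 (k ε ε)) :=
          (kcont ε ε hε).tendsto.mono_left nhdsWithin_le_nhds
        refine this.eventually (gt_mem_nhds ?_)
        rw [hk]
        simpa using hy
      obtain ⟨a, hay, ha⟩ := (hev.and self_mem_nhdsWithin).exists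
      exact isPreconnected_Ioi.intermediate_value ha hb
        (fun s hs => (kcont ε s (hε.trans hs)).continuousWithinAt) ⟨hay.le, hyb⟩
  · intro s hs
    simp only [Set.mem_Ioi] at hs ⊢
    have h2 : 0 < s / 2 := by positivity
    have h1 := aux_lam2 μ (s / 2) h2
    rw [← hg, ← hlam] at h1
    rw [k0 s hs]
    exact h1.trans_lt (ginv _ _ h2 (by linarith))
  · intro y hy
    simp only [Set.mem_Ioi] at hy
    have hy0 : 0 < y := lamnn.trans_lt hy
    obtain ⟨b, hb, -, hyb⟩ := klarge 0 y le_rfl hy0.le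
    obtain ⟨a, ha, hay⟩ : ∃ a, 0 < a ∧ k a 0 ≤ y := by
      by_contra! H
      have := aux_lam μ y hy0 fun s hs => by
        have h1 := H s hs
        rw [k0 s hs, lt_inv_comm₀ hy0 (gpos s hs), hg] at h1
        rw [one_div y]
        exact h1.le
      rw [← hlam] at this
      linarith
    exact isPreconnected_Ioi.intermediate_value ha hb
      (fun s hs => (kcont 0 s hs).continuousWithinAt) ⟨hay, hyb⟩
end

section
/- For each ε > 0 and t > 0 there is a unique s = w(ε,t) ∈ (ε,∞) satisfying h_μ(s) = (s − ε)/t, and the function (ε,t) ↦ w(ε,t) is real-analytic on (0,∞) × (0,∞). Moreover: (i) if t > λ₁(μ)², then lim_{ε→0⁺} w(ε,t) = w(0,t), where w(0,t) is the unique s > 0 with ∫ 1/(s² + u²) dμ(u) = 1/t; (ii) if t ≤ λ₁(μ)², then lim_{ε→0⁺} w(ε,t) = 0. -/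
open MeasureTheory

namespace Stmt3Aux
open Filter Topology

lemma integrable_K (μ : Measure ℝ) [IsProbabilityMeasure μ] {s : ℝ} (hs : 0 < s) :
    Integrable (fun u : ℝ => (s ^ 2 + u ^ 2)⁻¹) μ := by
  refine Integrable.of_bound (C := (s ^ 2)⁻¹) (by
    apply Measurable.aestronglyMeasurable; fun_prop) (Eventually.of_forall fun u => ?_)
  rw [Real.norm_of_nonneg (by positivity)]
  gcongr
  nlinarith [sq_nonneg u]

lemma analytic_Kc (μ : Measure ℝ) [IsProbabilityMeasure μ] {v : ℂ} (hv : 0 < v.re) :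
    AnalyticAt ℂ (fun z : ℂ => ∫ u : ℝ, (z + (u : ℂ) ^ 2)⁻¹ ∂μ) v := by
  have hbd : ∀ (r : ℝ) (z : ℂ) (u : ℝ), 0 < r → r < z.re → ‖(z + (u : ℂ) ^ 2)⁻¹‖ ≤ r⁻¹ := by
    intro r z u hr hz
    rw [norm_inv]
    gcongr
    refine le_trans ?_ (Complex.re_le_norm _)
    have : (z + (u : ℂ) ^ 2).re = z.re + u ^ 2 := by
      rw [← Complex.ofReal_pow, Complex.add_re, Complex.ofReal_re]
    rw [this]; nlinarith [sq_nonneg u]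
  have hne : ∀ (z : ℂ) (u : ℝ), 0 < z.re → z + (u : ℂ) ^ 2 ≠ 0 := by
    intro z u hz h0
    have : (z + (u : ℂ) ^ 2).re = z.re + u ^ 2 := by
      rw [← Complex.ofReal_pow, Complex.add_re, Complex.ofReal_re]
    rw [h0] at this
    simp at this
    nlinarith [sq_nonneg u]
  rw [Complex.analyticAt_iff_eventually_differentiableAt]
  have hopen : ∀ r : ℝ, IsOpen {z : ℂ | r < z.re} := fun r =>
    isOpen_lt continuous_const Complex.continuous_re
  filter_upwards [(hopen 0).mem_nhds hv] with z hz
  have hz : 0 < z.re := hz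
  have hmeas : ∀ z : ℂ, AEStronglyMeasurable (fun u : ℝ => (z + (u : ℂ) ^ 2)⁻¹) μ := by
    intro z
    apply Measurable.aestronglyMeasurable; fun_prop
  have := hasDerivAt_integral_of_dominated_loc_of_deriv_le (μ := μ) (𝕜 := ℂ)
    (F := fun (z : ℂ) (u : ℝ) => (z + (u : ℂ) ^ 2)⁻¹)
    (F' := fun (z : ℂ) (u : ℝ) => - 1 / (z + (u : ℂ) ^ 2) ^ 2)
    (x₀ := z) (s := {x : ℂ | z.re / 2 < x.re}) (bound := fun _ => ((z.re / 2)⁻¹) ^ 2)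
    ((hopen _).mem_nhds (by simp; linarith))
    (Eventually.of_forall fun z => hmeas z)
    (Integrable.of_bound (hmeas z) (C := (z.re / 2)⁻¹)
      (Eventually.of_forall fun u => hbd _ _ _ (by linarith) (by linarith)))
    (by apply Measurable.aestronglyMeasurable; fun_prop)
    (Eventually.of_forall fun u x hx => by
      have h1 := hbd (z.re / 2) x u (by linarith) hx
      have : ‖-1 / (x + (u : ℂ) ^ 2) ^ 2‖ = ‖(x + (u : ℂ) ^ 2)⁻¹‖ ^ 2 := by
        simp [norm_pow, div_eq_mul_inv]
      rw [this]
      gcongr)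
    (integrable_const _)
    (Eventually.of_forall fun u x hx => by
      have hx : z.re / 2 < x.re := hx
      exact ((hasDerivAt_id x).add_const _).fun_inv (hne x u (by linarith)))
  exact this.2.differentiableAt

lemma analytic_G (μ : Measure ℝ) [IsProbabilityMeasure μ] {s : ℝ} (hs : 0 < s) :
    AnalyticAt ℝ (fun s : ℝ => ∫ u : ℝ, (s ^ 2 + u ^ 2)⁻¹ ∂μ) s := by
  have h1 := (analytic_Kc μ (v := ((s ^ 2 : ℝ) : ℂ)) (by rw [Complex.ofReal_re]; positivity)).restrictScalars (𝕜 := ℝ)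
  have h2 : AnalyticAt ℝ (fun s : ℝ => ((s ^ 2 : ℝ) : ℂ)) s :=
    (Complex.ofRealCLM.analyticAt (s ^ 2)).fun_comp (f := fun s : ℝ => s ^ 2) (x := s) (by fun_prop)
  have h3 := (Complex.reCLM.analyticAt _).comp (h1.fun_comp (f := fun s : ℝ => ((s ^ 2 : ℝ) : ℂ)) (x := s) h2)
  refine h3.congr (Eventually.of_forall fun x => ?_)
  simp only [Function.comp, Complex.reCLM_apply]
  have : (∫ u : ℝ, (((x ^ 2 : ℝ) : ℂ) + (u : ℂ) ^ 2)⁻¹ ∂μ)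
      = ∫ u : ℝ, (((x ^ 2 + u ^ 2)⁻¹ : ℝ) : ℂ) ∂μ := by
    congr 1; ext u; push_cast; rfl
  rw [this, integral_complex_ofReal, Complex.ofReal_re]

lemma strictAnti_G (μ : Measure ℝ) [IsProbabilityMeasure μ] {a b : ℝ} (ha : 0 < a) (hab : a < b) :
    (∫ u : ℝ, (b ^ 2 + u ^ 2)⁻¹ ∂μ) < ∫ u : ℝ, (a ^ 2 + u ^ 2)⁻¹ ∂μ := by
  have hlt : ∀ u : ℝ, (b ^ 2 + u ^ 2)⁻¹ < (a ^ 2 + u ^ 2)⁻¹ := fun u => by gcongr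
  rw [← sub_pos, ← integral_sub (integrable_K μ ha) (integrable_K μ (ha.trans hab)),
    integral_pos_iff_support_of_nonneg (f := fun u : ℝ => (a ^ 2 + u ^ 2)⁻¹ - (b ^ 2 + u ^ 2)⁻¹)
      (fun u => by simpa using (hlt u).le)
      ((integrable_K μ ha).sub (integrable_K μ (ha.trans hab)))]
  have : Function.support (fun u : ℝ => (a ^ 2 + u ^ 2)⁻¹ - (b ^ 2 + u ^ 2)⁻¹) = Set.univ := by
    ext u; simpa [sub_eq_zero] using (hlt u).ne'
  rw [this]; simp

lemma G_le (μ : Measure ℝ) [IsProbabilityMeasure μ] {s : ℝ} (hs : 0 < s) :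
    (∫ u : ℝ, (s ^ 2 + u ^ 2)⁻¹ ∂μ) ≤ (s ^ 2)⁻¹ := by
  have := integral_mono (integrable_K μ hs) (integrable_const ((s ^ 2)⁻¹))
    (fun u => by
      change (s ^ 2 + u ^ 2)⁻¹ ≤ (s ^ 2)⁻¹
      gcongr; nlinarith [sq_nonneg u])
  simpa using this

lemma G_pos (μ : Measure ℝ) [IsProbabilityMeasure μ] {s : ℝ} (hs : 0 < s) :
    0 < (∫ u : ℝ, (s ^ 2 + u ^ 2)⁻¹ ∂μ) := by
  rw [integral_pos_iff_support_of_nonneg (fun u => by positivity) (integrable_K μ hs)]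
  have : Function.support (fun u : ℝ => (s ^ 2 + u ^ 2)⁻¹) = Set.univ := by
    ext u
    have : (s ^ 2 + u ^ 2)⁻¹ ≠ 0 := by positivity
    simpa using this
  rw [this]; simp

lemma lam_iff (μ : Measure ℝ) [IsProbabilityMeasure μ] {t : ℝ} (ht : 0 < t) :
    t ≤ ((∫⁻ u, (ENNReal.ofReal (u ^ 2))⁻¹ ∂μ)⁻¹).toReal ↔
      (∫⁻ u, (ENNReal.ofReal (u ^ 2))⁻¹ ∂μ) ≤ ENNReal.ofReal (1 / t) := by
  set L := ∫⁻ u, (ENNReal.ofReal (u ^ 2))⁻¹ ∂μ with hL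
  have hL0 : L ≠ 0 := by
    rw [hL, ← pos_iff_ne_zero, lintegral_pos_iff_support (by fun_prop)]
    have : Function.support (fun u : ℝ => (ENNReal.ofReal (u ^ 2))⁻¹) = Set.univ := by
      ext u; simp
    rw [this]; simp
  rw [← ENNReal.ofReal_le_iff_le_toReal (by simpa using hL0), one_div, ENNReal.ofReal_inv_of_pos ht,
    ENNReal.le_inv_iff_le_inv]

lemma ofReal_G (μ : Measure ℝ) [IsProbabilityMeasure μ] {s : ℝ} (hs : 0 < s) :
    ENNReal.ofReal (∫ u : ℝ, (s ^ 2 + u ^ 2)⁻¹ ∂μ) =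
      ∫⁻ u : ℝ, (ENNReal.ofReal (s ^ 2 + u ^ 2))⁻¹ ∂μ := by
  rw [ofReal_integral_eq_lintegral_ofReal (integrable_K μ hs)
    (Eventually.of_forall fun u => by positivity)]
  congr 1; ext u
  rw [ENNReal.ofReal_inv_of_pos (by positivity)]

lemma lam_iff' (μ : Measure ℝ) [IsProbabilityMeasure μ] {t : ℝ} (ht : 0 < t) :
    t ≤ ((∫⁻ u, (ENNReal.ofReal (u ^ 2))⁻¹ ∂μ)⁻¹).toReal ↔
      ∀ s : ℝ, 0 < s → (∫ u : ℝ, (s ^ 2 + u ^ 2)⁻¹ ∂μ) ≤ 1 / t := by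
  rw [lam_iff μ ht]
  constructor
  · intro h s hs
    rw [← ENNReal.ofReal_le_ofReal_iff (by positivity), ofReal_G μ hs]
    refine le_trans (lintegral_mono fun u => ?_) h
    gcongr; nlinarith [sq_nonneg s]
  · intro h
    have key : ∀ u : ℝ, liminf (fun n : ℕ => (ENNReal.ofReal ((1 / ((n : ℝ) + 1)) ^ 2 + u ^ 2))⁻¹) atTop
        = (ENNReal.ofReal (u ^ 2))⁻¹ := by
      intro u
      apply Tendsto.liminf_eq
      refine (continuous_inv.tendsto _).comp ((ENNReal.continuous_ofReal.tendsto _).comp ?_)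
      have := ((tendsto_one_div_add_atTop_nhds_zero_nat (𝕜 := ℝ)).pow 2).add_const (u ^ 2)
      simpa using this
    calc _ = ∫⁻ u, liminf (fun n : ℕ => (ENNReal.ofReal ((1 / ((n : ℝ) + 1)) ^ 2 + u ^ 2))⁻¹) atTop ∂μ := by
            simp only [key]
      _ ≤ liminf (fun n : ℕ => ∫⁻ u, (ENNReal.ofReal ((1 / ((n : ℝ) + 1)) ^ 2 + u ^ 2))⁻¹ ∂μ) atTop :=
            lintegral_liminf_le (fun n => by fun_prop)
      _ ≤ ENNReal.ofReal (1 / t) := by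
            refine liminf_le_of_le (by isBoundedDefault) fun b hb => ?_
            obtain ⟨n, hn⟩ := hb.exists
            refine hn.trans ?_
            rw [← ofReal_G μ (by positivity)]
            exact ENNReal.ofReal_le_ofReal (h _ (by positivity))

/-- Analytic implicit function part. -/
lemma analytic_w (h : ℝ → ℝ) (w : ℝ → ℝ → ℝ) (ε t : ℝ) (hε : 0 < ε) (ht : 0 < t)
    (hw1 : ε < w ε t) (hw2 : h (w ε t) = (w ε t - ε) / t)
    (huniq : ∀ ε : ℝ, 0 < ε → ∀ t : ℝ, 0 < t → 
      ∀ s : ℝ, ε < s → h s = (s - ε) / t → s = w ε t)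
    (han : AnalyticAt ℝ h (w ε t)) (hd : 1 - t * deriv h (w ε t) ≠ 0) :
    AnalyticAt ℝ (fun p : ℝ × ℝ => w p.1 p.2) (ε, t) := by
  set s := w ε t with hs
  let f : ℝ × ℝ → ℝ × ℝ := fun p => (p.1 - p.2 * h p.1, p.2)
  have hfa : AnalyticAt ℝ f (s, t) := by
    have : AnalyticAt ℝ (fun p : ℝ × ℝ => h p.1) (s, t) := han.fun_comp (f := Prod.fst) analyticAt_fst
    exact (analyticAt_fst.sub (analyticAt_snd.mul this)).prod analyticAt_snd
  have hfs : f (s, t) = (ε, t) := by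
    simp only [f, hw2]; ext <;> simp; field_simp; ring
  have hh : HasFDerivAt (fun p : ℝ × ℝ => h p.1) (deriv h s • ContinuousLinearMap.fst ℝ ℝ ℝ) (s, t) :=
    HasDerivAt.comp_hasFDerivAt (s, t) (f := Prod.fst) han.differentiableAt.hasDerivAt hasFDerivAt_fst
  have hL := ((hasFDerivAt_fst (𝕜 := ℝ) (p := (s, t))).sub ((hasFDerivAt_snd (𝕜 := ℝ) (p := (s, t))).mul hh)).prodMk
    (hasFDerivAt_snd (𝕜 := ℝ) (p := (s, t)))
  have hinj : Function.Injective (fderiv ℝ f (s, t)) := by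
    have hL' : fderiv ℝ f (s, t) = _ := hL.fderiv
    rw [hL', injective_iff_map_eq_zero]
    rintro ⟨x, y⟩ hxy
    simp at hxy
    obtain ⟨h1, rfl⟩ := hxy
    have : (1 - t * deriv h s) * x = 0 := by linear_combination h1
    simpa [hd] using this
  let e : (ℝ × ℝ) ≃L[ℝ] (ℝ × ℝ) :=
    (LinearEquiv.ofInjectiveEndo (fderiv ℝ f (s, t) : (ℝ × ℝ) →ₗ[ℝ] (ℝ × ℝ)) hinj).toContinuousLinearEquiv
  have he : (e : (ℝ × ℝ) →L[ℝ] (ℝ × ℝ)) = fderiv ℝ f (s, t) := by ext <;> rfl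
  have hst : HasStrictFDerivAt f (e : (ℝ × ℝ) →L[ℝ] (ℝ × ℝ)) (s, t) := by
    rw [he]; exact hfa.hasStrictFDerivAt
  let R := hst.toOpenPartialHomeomorph f
  have hmem : (s, t) ∈ R.source := hst.mem_toOpenPartialHomeomorph_source
  have hR : R (s, t) = (ε, t) := hfs
  have hsymm : AnalyticAt ℝ R.symm (ε, t) := by
    rw [← hR]
    exact R.analyticAt_symm' hmem hfa he.symm
  have hsv : R.symm (ε, t) = (s, t) := by rw [← hR, R.left_inv hmem]
  have h1 : AnalyticAt ℝ (fun p => (R.symm p).1) (ε, t) := analyticAt_fst.fun_comp hsymm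
  refine h1.congr ?_
  have hright : ∀ᶠ p in 𝓝 (ε, t), R (R.symm p) = p := by
    have := R.eventually_right_inverse' hmem
    rwa [hR] at this
  have hcont : ∀ᶠ p in 𝓝 (ε, t), p.1 < (R.symm p).1 := by
    apply ContinuousAt.eventually_lt continuousAt_fst h1.continuousAt
    rw [hsv]; exact hw1
  have hp1 : ∀ᶠ p : ℝ × ℝ in 𝓝 (ε, t), 0 < p.1 := continuousAt_fst.eventually (lt_mem_nhds hε)
  have hp2 : ∀ᶠ p : ℝ × ℝ in 𝓝 (ε, t), 0 < p.2 := continuousAt_snd.eventually (lt_mem_nhds ht)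
  filter_upwards [hright, hcont, hp1, hp2] with p hr hc h1 h2
  refine huniq _ h1 _ h2 _ hc ?_
  have hr : f (R.symm p) = p := hr
  have hr' : ((R.symm p).1 - (R.symm p).2 * h (R.symm p).1, (R.symm p).2) = p := hr
  have e2 : (R.symm p).2 = p.2 := (Prod.ext_iff.1 hr').2
  have e1 : (R.symm p).1 - (R.symm p).2 * h (R.symm p).1 = p.1 := (Prod.ext_iff.1 hr').1
  rw [e2] at e1
  rw [eq_div_iff h2.ne']
  linarith

end Stmt3Aux

open Stmt3Aux in
/-- Let `μ` be a Borel probability measure on `[0,∞)`, with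
`h_μ(s) = ∫ s/(s²+u²) dμ(u)` and `λ₁(μ)² = (∫ 1/u² dμ(u))⁻¹` (extended sense).
For each `ε, t > 0` there is a unique `s = w(ε,t) ∈ (ε,∞)` with `h_μ(s) = (s−ε)/t`,
and `(ε,t) ↦ w(ε,t)` is real-analytic on `(0,∞)×(0,∞)`. Moreover:
(i) if `t > λ₁(μ)²` then `w(ε,t) → w(0,t)` as `ε → 0⁺`, where `w(0,t)` is the unique
`s > 0` with `∫ 1/(s²+u²) dμ(u) = 1/t`; (ii) if `t ≤ λ₁(μ)²` then `w(ε,t) → 0`. -/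
theorem stmt_3 (μ : Measure ℝ) [IsProbabilityMeasure μ] (hsupp : μ (Set.Iio 0) = 0)
    (h : ℝ → ℝ) (hh : ∀ s : ℝ, h s = ∫ u, s / (s ^ 2 + u ^ 2) ∂μ)
    (lamSq : ℝ)
    (hlam : lamSq = ((∫⁻ u, (ENNReal.ofReal (u ^ 2))⁻¹ ∂μ)⁻¹).toReal) :
    ∃ w : ℝ → ℝ → ℝ,
      (∀ ε : ℝ, 0 < ε → ∀ t : ℝ, 0 < t →
        (ε < w ε t ∧ h (w ε t) = (w ε t - ε) / t) ∧
        (∀ s : ℝ, ε < s → h s = (s - ε) / t → s = w ε t)) ∧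
      AnalyticOnNhd ℝ (fun p : ℝ × ℝ => w p.1 p.2)
        (Set.Ioi (0 : ℝ) ×ˢ Set.Ioi (0 : ℝ)) ∧
      (∀ t : ℝ, lamSq < t →
        ∃! s : ℝ, 0 < s ∧ (∫ u, (s ^ 2 + u ^ 2)⁻¹ ∂μ) = 1 / t) ∧
      (∀ t : ℝ, lamSq < t → ∀ s : ℝ,
        (0 < s ∧ (∫ u, (s ^ 2 + u ^ 2)⁻¹ ∂μ) = 1 / t) →
        Filter.Tendsto (fun ε => w ε t) (nhdsWithin 0 (Set.Ioi 0)) (nhds s)) ∧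
      (∀ t : ℝ, 0 < t → t ≤ lamSq →
        Filter.Tendsto (fun ε => w ε t) (nhdsWithin 0 (Set.Ioi 0)) (nhds 0)) := by
  classical
  set G : ℝ → ℝ := fun s => ∫ u, (s ^ 2 + u ^ 2)⁻¹ ∂μ with hG
  have hhG : ∀ s, h s = s * G s := by
    intro s
    rw [hh, hG, ← integral_const_mul]
    simp only [div_eq_mul_inv]
  have hanti : ∀ {a b : ℝ}, 0 < a → a < b → G b < G a := fun ha hab => strictAnti_G μ ha hab
  have hGan : ∀ {s : ℝ}, 0 < s → AnalyticAt ℝ G s := fun hs => analytic_G μ hs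
  have hGpos : ∀ {s : ℝ}, 0 < s → 0 < G s := fun hs => G_pos μ hs
  have hGle : ∀ {s : ℝ}, 0 < s → G s ≤ (s ^ 2)⁻¹ := fun hs => G_le μ hs
  have hGinj : ∀ {a b : ℝ}, 0 < a → 0 < b → G a = G b → a = b := by
    intro a b ha hb hab
    rcases lt_trichotomy a b with hl | hl | hl
    · have := hanti ha hl; linarith
    · exact hl
    · have := hanti hb hl; linarith
  -- equivalent form of the equation
  have hequiv : ∀ {ε t s : ℝ}, 0 < t → 0 < s → h s = (s - ε) / t → t * G s = 1 - ε / s := by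
    intro ε t s ht hs he
    rw [hhG] at he
    field_simp at he ⊢
    linarith
  have huniq : ∀ {ε t s s' : ℝ}, 0 < ε → 0 < t → ε < s → ε < s' → t * G s = 1 - ε / s →
      t * G s' = 1 - ε / s' → ¬ s < s' := by
    intro ε t s s' hε ht hs hs' e e' hlt
    have h1 := mul_lt_mul_of_pos_left (hanti (hε.trans hs) hlt) ht
    have h2 : ε / s' < ε / s := div_lt_div_of_pos_left hε (hε.trans hs) hlt
    linarith
  have hex : ∀ ε t : ℝ, 0 < ε → 0 < t → ∃ s, ε < s ∧ h s = (s - ε) / t := by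
    intro ε t hε ht
    have hle : ε ≤ ε + t / ε := by have := div_pos ht hε; linarith
    have hc : ContinuousOn (fun s => t * (s * G s) - (s - ε)) (Set.Icc ε (ε + t / ε)) := by
      intro s hs
      have : ContinuousAt G s := (hGan (hε.trans_le hs.1)).continuousAt
      apply ContinuousAt.continuousWithinAt
      fun_prop
    have := intermediate_value_Icc' hle hc
    have hmem : (0 : ℝ) ∈ Set.Icc (t * ((ε + t / ε) * G (ε + t / ε)) - (ε + t / ε - ε))
        (t * (ε * G ε) - (ε - ε)) := by
      have hS : 0 < ε + t / ε := by positivity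
      have hP := hGpos hε
      constructor
      · have h1 : (ε + t / ε) * G (ε + t / ε) ≤ (ε + t / ε)⁻¹ := by
          calc _ ≤ (ε + t / ε) * ((ε + t / ε) ^ 2)⁻¹ :=
                mul_le_mul_of_nonneg_left (hGle hS) hS.le
            _ = _ := by field_simp
        have h2 : (ε + t / ε)⁻¹ ≤ ε⁻¹ := by gcongr
        have h3 := mul_le_mul_of_nonneg_left (h1.trans h2) ht.le
        rw [← div_eq_mul_inv] at h3
        linarith
      · have : 0 < t * (ε * G ε) := by positivity
        linarith
    obtain ⟨s, hs, he⟩ := this hmem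
    have he : t * (s * G s) - (s - ε) = 0 := he
    have hs0 : 0 < s := hε.trans_le hs.1
    have hp : 0 < t * (s * G s) := by have := hGpos hs0; positivity
    refine ⟨s, by linarith, ?_⟩
    rw [hhG, eq_div_iff ht.ne']
    linarith
  choose! w hw using hex
  have hmain : ∀ ε : ℝ, 0 < ε → ∀ t : ℝ, 0 < t →
        (ε < w ε t ∧ h (w ε t) = (w ε t - ε) / t) ∧
        (∀ s : ℝ, ε < s → h s = (s - ε) / t → s = w ε t) := by
    intro ε hε t ht
    obtain ⟨h1, h2⟩ := hw ε t hε ht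
    refine ⟨⟨h1, h2⟩, fun s hs he => ?_⟩
    have e1 := hequiv ht (hε.trans hs) he
    have e2 := hequiv ht (hε.trans h1) h2
    exact le_antisymm (not_lt.1 (huniq hε ht h1 hs e2 e1)) (not_lt.1 (huniq hε ht hs h1 e1 e2))
  -- upper control
  have hup : ∀ t : ℝ, 0 < t → ∀ a : ℝ, 0 < a → t * G a < 1 →
      ∀ᶠ ε in nhdsWithin (0 : ℝ) (Set.Ioi 0), w ε t < a := by
    intro t ht a ha hlt
    have hpos : 0 < a * (1 - t * G a) := mul_pos ha (by linarith)
    filter_upwards [Ioo_mem_nhdsGT hpos] with ε hε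
    obtain ⟨⟨h1, h2⟩, -⟩ := hmain ε hε.1 t ht
    by_contra! hge
    have e2 := hequiv ht (hε.1.trans h1) h2
    have h3 : G (w ε t) ≤ G a := by
      rcases hge.eq_or_lt with he | hl
      · rw [he]
      · exact (hanti ha hl).le
    have h4 := mul_le_mul_of_nonneg_left h3 ht.le
    have h5 : ε / w ε t ≤ ε / a := div_le_div_of_nonneg_left hε.1.le ha hge
    have h6 : ε / a < 1 - t * G a := by
      rw [div_lt_iff₀ ha]; linarith [hε.2]
    linarith
  have hlam0 : 0 ≤ lamSq := by rw [hlam]; exact ENNReal.toReal_nonneg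
  refine ⟨w, hmain, ?_, ?_, ?_, ?_⟩
  · rintro ⟨ε, t⟩ ⟨hε, ht⟩
    have hε : 0 < ε := hε
    have ht : 0 < t := ht
    obtain ⟨⟨h1, h2⟩, -⟩ := hmain ε hε t ht
    have hs0 : 0 < w ε t := hε.trans h1
    have hhG' : h = fun s => s * G s := funext hhG
    refine analytic_w h w ε t hε ht h1 h2 (fun ε hε t ht => (hmain ε hε t ht).2) ?_ ?_
    · rw [hhG']; exact analyticAt_id.mul (hGan hs0)
    · have hd : deriv h (w ε t) = G (w ε t) + w ε t * deriv G (w ε t) := by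
        rw [hhG']
        have := (hasDerivAt_id' (w ε t)).fun_mul (hGan hs0).differentiableAt.hasDerivAt
        have := this.deriv
        simpa using this
      have hneg : deriv G (w ε t) ≤ 0 := by
        rw [← derivWithin_of_isOpen isOpen_Ioi (Set.mem_Ioi.2 hs0)]
        exact AntitoneOn.derivWithin_nonpos (StrictAntiOn.antitoneOn
          (fun a ha b hb hab => hanti ha hab))
      have e2 := hequiv ht hs0 h2
      have h3 : 0 < ε / w ε t := div_pos hε hs0
      have h4 : t * (w ε t * deriv G (w ε t)) ≤ 0 :=
        mul_nonpos_of_nonneg_of_nonpos ht.le (mul_nonpos_of_nonneg_of_nonpos hs0.le hneg)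
      rw [hd]
      apply ne_of_gt
      linarith
  · intro t hlt
    have ht : 0 < t := hlam0.trans_lt hlt
    have : ∃ a, 0 < a ∧ 1 / t < G a := by
      by_contra! hcon
      exact absurd ((lam_iff' μ ht).2 hcon) (by rw [← hlam]; exact not_le.2 hlt)
    obtain ⟨a, ha, hGa⟩ := this
    have hst : 0 < Real.sqrt t := Real.sqrt_pos.2 ht
    have hGt : G (Real.sqrt t) ≤ 1 / t := by
      have := hGle hst
      rwa [Real.sq_sqrt ht.le, ← one_div] at this
    have hat : a ≤ Real.sqrt t := by
      by_contra! hlt'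
      have := hanti hst hlt'
      linarith
    obtain ⟨s, hs, hGs⟩ := intermediate_value_Icc' (f := G) hat
      (fun s hs => (hGan (ha.trans_le hs.1)).continuousAt.continuousWithinAt) ⟨hGt, hGa.le⟩
    refine ⟨s, ⟨ha.trans_le hs.1, hGs⟩, ?_⟩
    rintro s' ⟨hs', hGs'⟩
    exact hGinj hs' (ha.trans_le hs.1) (hGs'.trans hGs.symm)
  · rintro t hlt s ⟨hs, hGs⟩
    have ht : 0 < t := hlam0.trans_lt hlt
    have hGs : t * G s = 1 := by
      change G s = 1 / t at hGs
      rw [hGs]; field_simp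
    rw [tendsto_order]
    constructor
    · intro a ha
      filter_upwards [self_mem_nhdsWithin] with ε hε
      have hε : 0 < ε := hε
      obtain ⟨⟨h1, h2⟩, -⟩ := hmain ε hε t ht
      have hs0 : 0 < w ε t := hε.trans h1
      have e2 := hequiv ht hs0 h2
      have h3 : 0 < ε / w ε t := div_pos hε hs0
      refine ha.trans_le ?_
      by_contra! hcon
      have := mul_lt_mul_of_pos_left (hanti hs0 hcon) ht
      linarith
    · intro a ha
      refine hup t ht a (hs.trans ha) ?_
      have := mul_lt_mul_of_pos_left (hanti hs ha) ht
      linarith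
  · intro t ht hle
    rw [hlam, lam_iff' μ ht] at hle
    rw [tendsto_order]
    constructor
    · intro a ha
      filter_upwards [self_mem_nhdsWithin] with ε hε
      have hε : 0 < ε := hε
      exact ha.trans (hε.trans (hmain ε hε t ht).1.1)
    · intro a ha
      refine hup t ht a ha ?_
      have h1 : G (a / 2) ≤ 1 / t := hle (a / 2) (by linarith)
      have h2 := hanti (half_pos ha) (half_lt_self ha)
      have h3 := mul_lt_mul_of_pos_left (h2.trans_le h1) ht
      rwa [mul_one_div_cancel ht.ne'] at h3
end

section
/- For every s ∈ I and θ ∈ ℝ, writing r = √(1+s), one has r e^{iθ} + r e^{−iθ} (1 − (√(4(1+s)+t²) − t)/(2(1+s))) = a(s) cos θ + i b(s) sin θ. Moreover, the functions a and b are strictly positive and strictly increasing on I. -/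
lemma aux17 (t : ℝ) (ht : 0 < t) (s : ℝ) (hs : s ∈ Set.Ioo (max (1 - t) 0 - 1) t) (b : ℝ)
    (hb : b = (Real.sqrt (4 * (1 + s) + t ^ 2) - t) / (2 * Real.sqrt (1 + s))) :
    0 < Real.sqrt (1 + s) ∧ 0 < b ∧ b < 1 ∧ Real.sqrt (1 + s) * (1 - b ^ 2) = t * b ∧
      1 - b ^ 2 < 2 * t := by
  obtain ⟨h1, h2⟩ := hs
  have h3 : 0 < 1 + s := by linarith [le_max_right (1 - t) 0]
  have h4 : 1 - t < 1 + s := by linarith [le_max_left (1 - t) 0]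
  have hr : 0 < Real.sqrt (1 + s) := Real.sqrt_pos.2 h3
  have hr2 : Real.sqrt (1 + s) ^ 2 = 1 + s := Real.sq_sqrt h3.le
  have hq2 : Real.sqrt (4 * (1 + s) + t ^ 2) ^ 2 = 4 * (1 + s) + t ^ 2 :=
    Real.sq_sqrt (by positivity)
  have hq : t < Real.sqrt (4 * (1 + s) + t ^ 2) := Real.lt_sqrt_of_sq_lt (by linarith)
  generalize Real.sqrt (1 + s) = r at *
  generalize Real.sqrt (4 * (1 + s) + t ^ 2) = q at *
  have hb0 : 0 < b := by rw [hb]; exact div_pos (by linarith) (by linarith)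
  have hqb : q = 2 * r * b + t := by rw [hb]; field_simp; ring
  have he : r * (1 - b ^ 2) = t * b := by
    have : r * (r * (1 - b ^ 2)) = r * (t * b) := by
      rw [hqb] at hq2; nlinarith
    exact mul_left_cancel₀ hr.ne' this
  have hu : 0 < 1 - b ^ 2 := by
    have : 0 < r * (1 - b ^ 2) := by rw [he]; positivity
    exact pos_of_mul_pos_right this hr.le
  have hb1 : b < 1 := by nlinarith
  refine ⟨hr, hb0, hb1, he, ?_⟩
  by_contra hc
  push Not at hc
  have ht2 : t < 1 / 2 := by nlinarith
  have h5 : (1 + s) * (1 - b ^ 2) ^ 2 = t ^ 2 * b ^ 2 := by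
    rw [← hr2, ← mul_pow, he, mul_pow]
  have h6 : (2 * t) ^ 2 ≤ (1 - b ^ 2) ^ 2 := pow_le_pow_left₀ (by linarith) hc 2
  have h7 : (1 / 2) * (2 * t) ^ 2 ≤ (1 + s) * (1 - b ^ 2) ^ 2 :=
    mul_le_mul (by linarith) h6 (by positivity) h3.le
  have h8 : t ^ 2 * b ^ 2 < t ^ 2 * 1 := mul_lt_mul_of_pos_left (by linarith) (by positivity)
  nlinarith

/-- Fix `t > 0`. For `1+s > 0` set
`a(s) = 2√(1+s) − (√(4(1+s)+t²) − t)/(2√(1+s))`,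
`b(s) = (√(4(1+s)+t²) − t)/(2√(1+s))`, and `I = (max(1−t,0)−1, t)`. Then for every
`s ∈ I` and `θ ∈ ℝ`, with `r = √(1+s)`,
`r e^{iθ} + r e^{−iθ}(1 − (√(4(1+s)+t²) − t)/(2(1+s))) = a(s) cos θ + i b(s) sin θ`;
moreover `a` and `b` are strictly positive and strictly increasing on `I`. -/
theorem stmt_17 (t : ℝ) (ht : 0 < t)
    (a b : ℝ → ℝ)
    (ha : ∀ s : ℝ, a s = 2 * Real.sqrt (1 + s)
      - (Real.sqrt (4 * (1 + s) + t ^ 2) - t) / (2 * Real.sqrt (1 + s)))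
    (hb : ∀ s : ℝ, b s = (Real.sqrt (4 * (1 + s) + t ^ 2) - t)
      / (2 * Real.sqrt (1 + s)))
    (I : Set ℝ) (hI : I = Set.Ioo (max (1 - t) 0 - 1) t) :
    (∀ s ∈ I, ∀ θ : ℝ,
      ((Real.sqrt (1 + s) : ℝ) : ℂ) * Complex.exp ((θ : ℂ) * Complex.I)
        + ((Real.sqrt (1 + s) : ℝ) : ℂ) * Complex.exp (-(θ : ℂ) * Complex.I)
          * (((1 - (Real.sqrt (4 * (1 + s) + t ^ 2) - t) / (2 * (1 + s)) : ℝ)) : ℂ)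
      = (((a s * Real.cos θ : ℝ)) : ℂ) + Complex.I * (((b s * Real.sin θ : ℝ)) : ℂ)) ∧
    (∀ s ∈ I, 0 < a s ∧ 0 < b s) ∧
    StrictMonoOn a I ∧ StrictMonoOn b I := by
  subst hI
  have key := fun s hs => aux17 t ht s hs (b s) (hb s)
  have hab : ∀ s, a s = 2 * Real.sqrt (1 + s) - b s := fun s => by rw [ha, hb]
  have hbm : StrictMonoOn b (Set.Ioo (max (1 - t) 0 - 1) t) := by
    intro x hx y hy hxy
    obtain ⟨r1, b1, c1, e1, u1⟩ := key x hx
    obtain ⟨r2, b2, c2, e2, u2⟩ := key y hy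
    have hr : Real.sqrt (1 + x) < Real.sqrt (1 + y) :=
      Real.sqrt_lt_sqrt (Real.sqrt_pos.1 r1).le (by linarith)
    by_contra hc
    push Not at hc
    have h1 : t * b y ≤ t * b x := mul_le_mul_of_nonneg_left hc ht.le
    have h2 : (b y) ^ 2 ≤ (b x) ^ 2 := pow_le_pow_left₀ b2.le hc 2
    have h3 : Real.sqrt (1 + x) * (1 - b x ^ 2) ≤ Real.sqrt (1 + x) * (1 - b y ^ 2) :=
      mul_le_mul_of_nonneg_left (by linarith) r1.le
    have h4 : Real.sqrt (1 + x) * (1 - b y ^ 2) < Real.sqrt (1 + y) * (1 - b y ^ 2) :=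
      mul_lt_mul_of_pos_right hr (by nlinarith)
    linarith
  refine ⟨?_, ?_, ?_, hbm⟩
  · intro s hs θ
    obtain ⟨r1, b1, c1, e1, u1⟩ := key s hs
    have h3 : 0 < 1 + s := Real.sqrt_pos.1 r1
    have hr2 : Real.sqrt (1 + s) ^ 2 = 1 + s := Real.sq_sqrt h3.le
    have hc : (1 - (Real.sqrt (4 * (1 + s) + t ^ 2) - t) / (2 * (1 + s)))
        = 1 - b s / Real.sqrt (1 + s) := by
      rw [hb, div_div, mul_assoc, ← sq, hr2]
    rw [hc, hab]
    have hne : ((Real.sqrt (1 + s) : ℝ) : ℂ) ≠ 0 := by exact_mod_cast r1.ne'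
    rw [Complex.exp_mul_I, Complex.exp_mul_I, Complex.cos_neg, Complex.sin_neg]
    push_cast
    field_simp
    ring
  · intro s hs
    obtain ⟨r1, b1, c1, e1, u1⟩ := key s hs
    refine ⟨?_, b1⟩
    rw [hab]
    by_contra hc
    push Not at hc
    have h1 : Real.sqrt (1 + s) * (1 - b s ^ 2) < Real.sqrt (1 + s) * (2 * t) :=
      mul_lt_mul_of_pos_left u1 r1
    nlinarith
  · intro x hx y hy hxy
    have hlt := hbm hx hy hxy
    obtain ⟨r1, b1, c1, e1, u1⟩ := key x hx
    obtain ⟨r2, b2, c2, e2, u2⟩ := key y hy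
    rw [hab, hab]
    have v1 : 0 < 1 - b x ^ 2 := by nlinarith
    have v2 : 0 < 1 - b y ^ 2 := by nlinarith
    have hd : (Real.sqrt (1 + y) - Real.sqrt (1 + x)) * ((1 - b x ^ 2) * (1 - b y ^ 2))
        = t * (b y - b x) * (1 + b x * b y) := by
      linear_combination (1 - b x ^ 2) * e2 - (1 - b y ^ 2) * e1
    have hU : (1 - b x ^ 2) * (1 - b y ^ 2) < 2 * t * (1 + b x * b y) := by
      have : 0 < t * (b x * b y) := by positivity
      nlinarith [mul_pos v1 (pow_pos b2 2)]
    have h1 : (b y - b x) * ((1 - b x ^ 2) * (1 - b y ^ 2))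
        < (2 * (Real.sqrt (1 + y) - Real.sqrt (1 + x))) * ((1 - b x ^ 2) * (1 - b y ^ 2)) := by
      have := mul_lt_mul_of_pos_left hU (sub_pos.2 hlt)
      nlinarith
    have := lt_of_mul_lt_mul_right h1 (mul_pos v1 v2).le
    linarith
end

section
/- The map F : I × ℝ → ℝ² defined by F(s,θ) = (a(s) cos θ, b(s) sin θ) is differentiable, and at every (s,θ) ∈ I × ℝ its Jacobian determinant equals a′(s) b(s) cos²θ + a(s) b′(s) sin²θ, which is strictly positive. -/
/-- Fix `t > 0`, with `a`, `b`, `I` as in the context. The map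
`F : I × ℝ → ℝ²`, `F(s,θ) = (a(s) cos θ, b(s) sin θ)`, is differentiable, and at every
`(s,θ) ∈ I × ℝ` its Jacobian determinant equals
`a′(s) b(s) cos²θ + a(s) b′(s) sin²θ > 0`. -/
theorem stmt_18 (t : ℝ) (ht : 0 < t)
    (a b : ℝ → ℝ)
    (ha : ∀ s : ℝ, a s = 2 * Real.sqrt (1 + s)
      - (Real.sqrt (4 * (1 + s) + t ^ 2) - t) / (2 * Real.sqrt (1 + s)))
    (hb : ∀ s : ℝ, b s = (Real.sqrt (4 * (1 + s) + t ^ 2) - t)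
      / (2 * Real.sqrt (1 + s)))
    (I : Set ℝ) (hI : I = Set.Ioo (max (1 - t) 0 - 1) t)
    (F : ℝ × ℝ → ℝ × ℝ)
    (hF : ∀ p : ℝ × ℝ, F p = (a p.1 * Real.cos p.2, b p.1 * Real.sin p.2)) :
    ∀ p ∈ I ×ˢ (Set.univ : Set ℝ),
      DifferentiableAt ℝ F p ∧
      LinearMap.det ((fderiv ℝ F p).toLinearMap)
        = deriv a p.1 * b p.1 * Real.cos p.2 ^ 2
          + a p.1 * deriv b p.1 * Real.sin p.2 ^ 2 ∧
      0 < deriv a p.1 * b p.1 * Real.cos p.2 ^ 2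
          + a p.1 * deriv b p.1 * Real.sin p.2 ^ 2 := by
  rintro ⟨s, θ⟩ hp
  have hs : s ∈ Set.Ioo (max (1 - t) 0 - 1) t := hI ▸ hp.1
  have h1 : 1 - t < 1 + s := by
    have := hs.1; have := le_max_left (1 - t) 0; linarith
  have h0 : 0 < 1 + s := by
    have := hs.1; have := le_max_right (1 - t) 0; linarith
  have hR0 : 0 < 4 * (1 + s) + t ^ 2 := by positivity
  have hid : HasDerivAt (fun x : ℝ => 1 + x) 1 s := (hasDerivAt_id s).const_add 1
  have hu' : HasDerivAt (fun x : ℝ => Real.sqrt (1 + x)) (1 / (2 * Real.sqrt (1 + s))) s :=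
    hid.sqrt h0.ne'
  have hr' : HasDerivAt (fun x : ℝ => Real.sqrt (4 * (1 + x) + t ^ 2))
      ((4 * 1) / (2 * Real.sqrt (4 * (1 + s) + t ^ 2))) s :=
    ((hid.const_mul 4).add_const (t ^ 2)).sqrt hR0.ne'
  have hu0 : 0 < Real.sqrt (1 + s) := Real.sqrt_pos.2 h0
  have hr0 : 0 < Real.sqrt (4 * (1 + s) + t ^ 2) := Real.sqrt_pos.2 hR0
  have hu2 : Real.sqrt (1 + s) ^ 2 = 1 + s := Real.sq_sqrt h0.le
  have hr2 : Real.sqrt (4 * (1 + s) + t ^ 2) ^ 2 = 4 * (1 + s) + t ^ 2 := Real.sq_sqrt hR0.le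
  have hbd := (hr'.sub_const t).div (hu'.const_mul 2) (by positivity)
  have had := (hu'.const_mul 2).sub hbd
  have hbs := hb s
  have has := ha s
  have hbf : b = fun x => (Real.sqrt (4 * (1 + x) + t ^ 2) - t) / (2 * Real.sqrt (1 + x)) :=
    funext hb
  have haf : a = fun x => 2 * Real.sqrt (1 + x)
      - (Real.sqrt (4 * (1 + x) + t ^ 2) - t) / (2 * Real.sqrt (1 + x)) := funext ha
  have hbD := hbd.congr_of_eventuallyEq (f₁ := b) (Filter.Eventually.of_forall hb)
  have haD := had.congr_of_eventuallyEq (f₁ := a) (Filter.Eventually.of_forall ha)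
  have hbv := hbD.deriv
  have hav := haD.deriv
  have hbD := hbD.differentiableAt.hasDerivAt
  have haD := haD.differentiableAt.hasDerivAt
  have hFf : F = fun p : ℝ × ℝ => (a p.1 * Real.cos p.2, b p.1 * Real.sin p.2) := funext hF
  have hA := (haD.comp_hasFDerivAt_of_eq (s, θ) (hasFDerivAt_fst (𝕜 := ℝ)) rfl).mul
    ((Real.hasDerivAt_cos θ).comp_hasFDerivAt_of_eq (s, θ) (hasFDerivAt_snd (𝕜 := ℝ) (E := ℝ)) rfl)
  have hB := (hbD.comp_hasFDerivAt_of_eq (s, θ) (hasFDerivAt_fst (𝕜 := ℝ)) rfl).mul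
    ((Real.hasDerivAt_sin θ).comp_hasFDerivAt_of_eq (s, θ) (hasFDerivAt_snd (𝕜 := ℝ) (E := ℝ)) rfl)
  have hFD := (hA.prodMk hB).congr_of_eventuallyEq (f₁ := F) (Filter.Eventually.of_forall hF)
  refine ⟨hFD.differentiableAt, ?_, ?_⟩
  · rw [hFD.fderiv, ← LinearMap.det_toMatrix (Module.Basis.finTwoProd ℝ), Matrix.det_fin_two]
    simp [LinearMap.toMatrix_apply]
    ring
  · show 0 < deriv a s * b s * Real.cos θ ^ 2 + a s * deriv b s * Real.sin θ ^ 2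
    clear hA hB hFD hFf hF hbd had hu' hr' hbD haD hbf haf
    generalize Real.sqrt (1 + s) = u at *
    generalize Real.sqrt (4 * (1 + s) + t ^ 2) = r at *
    have hrt : t < r := by nlinarith
    have hrt2 : 2 < r + t := by
      by_contra hc
      nlinarith
    have hfac : 4 * u ^ 2 = (r - t) * (r + t) := by rw [hu2]; linarith
    have hd : 0 < r - t := sub_pos.2 hrt
    have hbv2 : deriv b s = t * (r - t) / (4 * u ^ 3 * r) := by
      rw [hbv]
      field_simp
      linear_combination 4 * hfac
    have hbp : 0 < deriv b s := by rw [hbv2]; positivity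
    have hb0 : 0 < b s := by rw [hbs]; positivity
    have hap : 0 < deriv a s := by
      have : deriv a s = 1 / u - deriv b s := by rw [hav, hbv]; ring
      rw [this, hbv2, sub_pos, div_lt_div_iff₀ (by positivity) hu0]
      have : t < r * (r + t) := by nlinarith
      have : (r - t) * t < (r - t) * (r * (r + t)) := by gcongr
      have : t * (r - t) < 4 * u ^ 2 * r := by rw [hfac]; linarith
      nlinarith
    have ha0 : 0 < a s := by
      rw [has, sub_pos, div_lt_iff₀ (by positivity)]
      nlinarith
    have h2 := Real.sin_sq_add_cos_sq θ
    rcases (sq_nonneg (Real.cos θ)).eq_or_lt with h | h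
    · have : Real.sin θ ^ 2 = 1 := by linarith
      rw [this, ← h]
      have := mul_pos ha0 hbp
      linarith
    · have := mul_pos (mul_pos hap hb0) h
      have := mul_nonneg (mul_pos ha0 hbp).le (sq_nonneg (Real.sin θ))
      linarith
end
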